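/- First a priori error estimate (Theorem 5.1, estimate (5.1)): There exists a constant C depending only on γ and ρ such that the error between the exact solution and the dG(0) approximation satisfies ‖A^{1/2}(U_{1,N} − u_1(T))‖ + ‖U_{2,N} − u_2(T)‖ ≤ C Σ_{n=1}^N k_n ∫_{I_n} ( ‖A^{1/2} u_2'(t)‖ + ‖A u_1'(t)‖ ) dt. -/

import Mathlib

open MeasureTheory Finset
open scoped RealInnerProductSpace

/-- The time step `k_n = t_n − t_{n-1}`. -/
noncomputable def kstep (tp : ℕ → ℝ) (n : ℕ) : ℝ := tp n - tp (n - 1)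

/-- The quadrature weights
`ω_{n,j} = ∫_{I_n} ∫_{t_{j-1}}^{min(t_j, t)} β(t − s) ds dt` for `1 ≤ j ≤ n ≤ N`. -/
noncomputable def qweight (β : ℝ → ℝ) (tp : ℕ → ℝ) (n j : ℕ) : ℝ :=
  ∫ t in (tp (n - 1))..(tp n), ∫ s in (tp (j - 1))..(min (tp j) t), β (t - s)

/-- One step of the discrete energy identity: the memory term controls the increment of the
quadratic history energy. -/
theorem memory_energy_step {H : Type*} [NormedAddCommGroup H] [InnerProductSpace ℝ H]
    (c c' : ℕ → ℝ) (φ : ℕ → H) (n : ℕ) (hc : ∀ j ≤ n, 0 ≤ c' j) (hcc : ∀ j < n, c' j ≤ c j) :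
    (∑ j ∈ range (n + 1), c' j * ‖φ (n + 1) - φ j‖ ^ 2) ≤
      (∑ j ∈ range n, c j * ‖φ n - φ j‖ ^ 2) +
        2 * ⟪∑ j ∈ range (n + 1), c' j • (φ (n + 1) - φ j), φ (n + 1) - φ n⟫ := by
  have hmono : (∑ j ∈ range (n + 1), c' j * ‖φ n - φ j‖ ^ 2) ≤
      ∑ j ∈ range n, c j * ‖φ n - φ j‖ ^ 2 := by
    rw [sum_range_succ]
    simp only [sub_self, norm_zero, ne_eq, OfNat.ofNat_ne_zero, not_false_eq_true, zero_pow,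
      mul_zero, add_zero]
    exact sum_le_sum fun j hj =>
      mul_le_mul_of_nonneg_right (hcc j (mem_range.1 hj)) (sq_nonneg _)
  refine le_trans ?_ (add_le_add_left hmono _)
  rw [sum_inner, mul_sum, ← sum_add_distrib]
  refine sum_le_sum fun j hj => ?_
  have hj' := hc j (by simpa [Nat.lt_succ_iff] using hj)
  have key : ‖φ n - φ j‖ ^ 2 = ‖φ (n + 1) - φ j‖ ^ 2
      - 2 * ⟪φ (n + 1) - φ j, φ (n + 1) - φ n⟫ + ‖φ (n + 1) - φ n‖ ^ 2 := by
    rw [← norm_sub_sq_real]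
    congr 2
    abel
  rw [real_inner_smul_left, key]
  nlinarith [mul_nonneg hj' (sq_nonneg ‖φ (n + 1) - φ n‖)]

/-- Energy stability of the implicit scheme with a fading memory term. -/
theorem discrete_energy_stability {H : Type*} [NormedAddCommGroup H] [InnerProductSpace ℝ H]
    (B : H →L[ℝ] H) (hB : ∀ x y : H, ⟪B x, y⟫ = ⟪x, B y⟫) {ρ γ : ℝ} (hρ : 0 < ρ)
    (hγ1 : γ < 1) (N : ℕ) (k : ℕ → ℝ) (c : ℕ → ℕ → ℝ) (φ v g ε : ℕ → H)
    {V Φ : ℝ} (hV : ∀ n ≤ N, ‖v n‖ ≤ V) (hΦ : ∀ n ≤ N, ‖φ n‖ ≤ Φ)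
    (hφ0 : φ 0 = 0) (hv0 : v 0 = 0)
    (hc : ∀ n < N, ∀ j ≤ n, 0 ≤ c n j)
    (hcc : ∀ n, n + 1 < N → ∀ j ≤ n, c (n + 1) j ≤ c n j)
    (hcs : ∀ n < N, ∑ j ∈ range (n + 1), c n j ≤ γ)
    (h1 : ∀ n < N, φ (n + 1) - φ n = k n • B (v (n + 1)) + ε n)
    (h2 : ∀ n < N, ρ • (v (n + 1) - v n) + k n • B ((1 - γ) • φ (n + 1)
      + ∑ j ∈ range (n + 1), c n j • (φ (n + 1) - φ j)) = g n) (m : ℕ) (hm : m ≤ N) :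
    ρ * ‖v m‖ ^ 2 + (1 - γ) * ‖φ m‖ ^ 2 ≤
      2 * ∑ n ∈ range m, (‖g n‖ * V + 2 * ‖ε n‖ * Φ) := by
  suffices hs : ρ * ‖v m‖ ^ 2 + (1 - γ) * ‖φ m‖ ^ 2
      + ∑ j ∈ range m, c (m - 1) j * ‖φ m - φ j‖ ^ 2 ≤
      2 * ∑ n ∈ range m, (‖g n‖ * V + 2 * ‖ε n‖ * Φ) by
    refine le_trans (le_add_of_nonneg_right (sum_nonneg fun j hj => ?_)) hs
    have := mem_range.1 hj
    exact mul_nonneg (hc _ (by omega) _ (by omega)) (sq_nonneg _)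
  induction m with
  | zero => simp [hφ0, hv0]
  | succ n ih =>
    have hn : n < N := hm
    have ih := ih hn.le
    set Q := ∑ j ∈ range (n + 1), c n j • (φ (n + 1) - φ j) with hQ
    have hmem := memory_energy_step (c (n - 1)) (c n) φ n (hc n hn) (fun j hj => by
      obtain ⟨p, rfl⟩ : ∃ p, n = p + 1 := ⟨n - 1, by omega⟩
      exact hcc p hn j (by omega))
    have hΦ0 : 0 ≤ Φ := (norm_nonneg _).trans (hΦ (n + 1) hm)
    have hQn : ‖Q‖ ≤ γ * (2 * Φ) := by
      calc ‖Q‖ ≤ ∑ j ∈ range (n + 1), c n j * (2 * Φ) := by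
            refine norm_sum_le_of_le _ fun j hj => ?_
            have hj := mem_range.1 hj
            rw [norm_smul, Real.norm_of_nonneg (hc n hn j (by omega))]
            refine mul_le_mul_of_nonneg_left ?_ (hc n hn j (by omega))
            have h₁ := hΦ (n + 1) hm
            have h₂ := hΦ j (by omega)
            linarith [norm_sub_le (φ (n + 1)) (φ j)]
        _ ≤ γ * (2 * Φ) := by
            rw [← sum_mul]
            exact mul_le_mul_of_nonneg_right (hcs n hn) (by linarith)
    have hR : ‖(1 - γ) • φ (n + 1) + Q‖ ≤ 2 * Φ := by
      refine (norm_add_le _ _).trans ?_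
      rw [norm_smul, Real.norm_of_nonneg (by linarith)]
      nlinarith [hΦ (n + 1) hm]
    have htest : ρ * ⟪v (n + 1) - v n, v (n + 1)⟫ + (1 - γ) * ⟪φ (n + 1), φ (n + 1) - φ n⟫
        + ⟪Q, φ (n + 1) - φ n⟫ = ⟪g n, v (n + 1)⟫ + ⟪(1 - γ) • φ (n + 1) + Q, ε n⟫ := by
      rw [← h2 n hn, ← hQ, inner_add_left, real_inner_smul_left, real_inner_smul_left, hB,
        ← real_inner_smul_right _ _ (k n), eq_sub_of_add_eq (h1 n hn).symm,
        inner_sub_right _ (φ (n + 1) - φ n), inner_add_left _ _ (φ (n + 1) - φ n),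
        real_inner_smul_left _ (φ (n + 1) - φ n)]
      ring
    have hg : ⟪g n, v (n + 1)⟫ ≤ ‖g n‖ * V :=
      (real_inner_le_norm _ _).trans (mul_le_mul_of_nonneg_left (hV _ hm) (norm_nonneg _))
    have he : ⟪(1 - γ) • φ (n + 1) + Q, ε n⟫ ≤ 2 * ‖ε n‖ * Φ := by
      refine (real_inner_le_norm _ _).trans ?_
      nlinarith [norm_nonneg (ε n)]
    have hpol : ∀ x y : H, ‖x‖ ^ 2 - ‖y‖ ^ 2 ≤ 2 * ⟪x, x - y⟫ := fun x y => by
      have := norm_sub_sq_real x y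
      rw [inner_sub_right, real_inner_self_eq_norm_sq]
      nlinarith [sq_nonneg ‖x - y‖]
    have hpv := mul_le_mul_of_nonneg_left (hpol (v (n + 1)) (v n)) hρ.le
    have hpφ := mul_le_mul_of_nonneg_left (hpol (φ (n + 1)) (φ n)) (sub_nonneg.2 hγ1.le)
    rw [real_inner_comm] at hpv
    rw [← hQ] at hmem
    rw [sum_range_succ (fun n => ‖g n‖ * V + 2 * ‖ε n‖ * Φ) n, Nat.add_sub_cancel]
    linarith

/-- The primitive of `β` on the positive half line, extended by zero. -/
noncomputable def kernelPrimitive (β : ℝ → ℝ) (x : ℝ) : ℝ := ∫ s in (0:ℝ)..max x 0, β s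

section Kernel

variable {β : ℝ → ℝ}

theorem intervalIntegrable_of_nonneg (hβi : IntegrableOn β (Set.Ioi 0)) {a b : ℝ} (ha : 0 ≤ a)
    (hb : 0 ≤ b) : IntervalIntegrable β volume a b := by
  rw [intervalIntegrable_iff]
  exact hβi.mono_set fun x hx => lt_of_le_of_lt (le_min ha hb) hx.1

theorem kernelPrimitive_sub (hβi : IntegrableOn β (Set.Ioi 0)) (x y : ℝ) :
    kernelPrimitive β x - kernelPrimitive β y = ∫ s in (max y 0)..(max x 0), β s :=
  intervalIntegral.integral_interval_sub_left
    (intervalIntegrable_of_nonneg hβi le_rfl (le_max_right _ _))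
    (intervalIntegrable_of_nonneg hβi le_rfl (le_max_right _ _))

theorem kernelPrimitive_mono (hβ0 : ∀ s ∈ Set.Ioi (0:ℝ), 0 ≤ β s)
    (hβi : IntegrableOn β (Set.Ioi 0)) : Monotone (kernelPrimitive β) := fun x y h => by
  rw [← sub_nonneg, kernelPrimitive_sub hβi,
    intervalIntegral.integral_of_le (max_le_max_right 0 h)]
  exact setIntegral_nonneg measurableSet_Ioc fun s hs =>
    hβ0 s ((le_max_right x 0).trans_lt hs.1)

theorem kernelPrimitive_of_nonpos {x : ℝ} (h : x ≤ 0) : kernelPrimitive β x = 0 := by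
  simp [kernelPrimitive, max_eq_right h]

theorem kernelPrimitive_le (hβ0 : ∀ s ∈ Set.Ioi (0:ℝ), 0 ≤ β s)
    (hβi : IntegrableOn β (Set.Ioi 0)) (x : ℝ) :
    kernelPrimitive β x ≤ ∫ s in Set.Ioi (0:ℝ), β s := by
  rw [kernelPrimitive, intervalIntegral.integral_of_le (le_max_right _ _)]
  exact setIntegral_mono_set hβi ((ae_restrict_iff' measurableSet_Ioi).2
    (Filter.Eventually.of_forall hβ0)) (Filter.Eventually.of_forall fun s hs => hs.1)

theorem intervalIntegrable_kernelPrimitive (hβ0 : ∀ s ∈ Set.Ioi (0:ℝ), 0 ≤ β s)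
    (hβi : IntegrableOn β (Set.Ioi 0)) (d a b : ℝ) :
    IntervalIntegrable (fun t => kernelPrimitive β (t - d)) volume a b :=
  Monotone.intervalIntegrable fun _ _ h =>
    kernelPrimitive_mono hβ0 hβi (sub_le_sub_right h d)

theorem integral_kernel_eq (hβi : IntegrableOn β (Set.Ioi 0)) {a t : ℝ} (b : ℝ) (h : a ≤ t) :
    ∫ s in a..(min b t), β (t - s) = kernelPrimitive β (t - a) - kernelPrimitive β (t - b) := by
  rw [intervalIntegral.integral_comp_sub_left, kernelPrimitive_sub hβi,
    max_eq_left (sub_nonneg.2 h)]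
  congr 1
  rw [← max_sub_sub_left, sub_self]

theorem kernelPrimitive_sub_antitone (hβa : AntitoneOn β (Set.Ioi 0))
    (hβi : IntegrableOn β (Set.Ioi 0)) {a b t t' : ℝ} (hab : a ≤ b) (hb : b ≤ t) (ht : t ≤ t') :
    kernelPrimitive β (t' - a) - kernelPrimitive β (t' - b) ≤
      kernelPrimitive β (t - a) - kernelPrimitive β (t - b) := by
  have hI : ∀ r, b ≤ r → IntervalIntegrable (fun s => β (r - s)) volume a b := fun r hr => by
    have := (intervalIntegrable_of_nonneg hβi (sub_nonneg.2 (hab.trans hr))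
      (sub_nonneg.2 hr)).comp_sub_left r
    simpa using this
  rw [← integral_kernel_eq hβi b (hab.trans hb),
    ← integral_kernel_eq hβi b (hab.trans (hb.trans ht)), min_eq_left hb,
    min_eq_left (hb.trans ht)]
  refine intervalIntegral.integral_mono_on_of_le_Ioo hab (hI _ (hb.trans ht)) (hI _ hb)
    fun s hs => ?_
  refine hβa ?_ ?_ (sub_le_sub_right ht s) <;> simp only [Set.mem_Ioi, sub_pos]
  · exact hs.2.trans_le hb
  · exact hs.2.trans_le (hb.trans ht)

end Kernel

/-- Averages of an antitone function over consecutive intervals decrease. -/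
theorem average_le_of_antitoneOn {f : ℝ → ℝ} {a b c : ℝ} (hab : a < b) (hbc : b < c)
    (hf : AntitoneOn f (Set.Icc a c)) :
    (∫ t in b..c, f t) / (c - b) ≤ (∫ t in a..b, f t) / (b - a) := by
  have hb : b ∈ Set.Icc a c := ⟨hab.le, hbc.le⟩
  have h₁ : (∫ t in b..c, f t) ≤ f b * (c - b) := by
    have := intervalIntegral.integral_mono_on (μ := volume) (f := f) (g := fun _ => f b) hbc.le
      (AntitoneOn.intervalIntegrable (by
        rw [Set.uIcc_of_le hbc.le]
        exact hf.mono (Set.Icc_subset_Icc_left hab.le))) intervalIntegrable_const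
      fun t ht => hf hb ⟨hab.le.trans ht.1, ht.2⟩ ht.1
    simpa [mul_comm] using this
  have h₂ : f b * (b - a) ≤ ∫ t in a..b, f t := by
    have := intervalIntegral.integral_mono_on (μ := volume) (f := fun _ => f b) (g := f) hab.le
      intervalIntegrable_const (AntitoneOn.intervalIntegrable (by
        rw [Set.uIcc_of_le hab.le]
        exact hf.mono (Set.Icc_subset_Icc_right hbc.le)))
      fun t ht => hf ⟨ht.1, ht.2.trans hbc.le⟩ hb ht.2
    simpa [mul_comm] using this
  exact ((div_le_iff₀ (sub_pos.2 hbc)).2 h₁).trans ((le_div_iff₀ (sub_pos.2 hab)).2 h₂)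

section Weights

variable {β : ℝ → ℝ} {tp : ℕ → ℝ} {N : ℕ}

theorem partition_mono (htp : ∀ n < N, tp n < tp (n + 1)) {i j : ℕ} (hij : i ≤ j) (hj : j ≤ N) :
    tp i ≤ tp j := by
  induction j, hij using Nat.le_induction with
  | base => exact le_rfl
  | succ j _ ih => exact (ih (by omega)).trans (htp j hj).le

theorem qweight_eq (hβi : IntegrableOn β (Set.Ioi 0)) (htp : ∀ n < N, tp n < tp (n + 1))
    {n j : ℕ} (hn : n < N) (hj : j ≤ n) :
    qweight β tp (n + 1) (j + 1) = ∫ t in (tp n)..(tp (n + 1)),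
      (kernelPrimitive β (t - tp j) - kernelPrimitive β (t - tp (j + 1))) := by
  simp only [qweight, Nat.add_sub_cancel]
  refine intervalIntegral.integral_congr fun t ht => ?_
  rw [Set.uIcc_of_le (htp n hn).le] at ht
  exact integral_kernel_eq hβi _ ((partition_mono htp hj hn.le).trans ht.1)

theorem qweight_nonneg (hβ0 : ∀ s ∈ Set.Ioi (0:ℝ), 0 ≤ β s) (hβi : IntegrableOn β (Set.Ioi 0))
    (htp : ∀ n < N, tp n < tp (n + 1)) {n j : ℕ} (hn : n < N) (hj : j ≤ n) :
    0 ≤ qweight β tp (n + 1) (j + 1) := by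
  rw [qweight_eq hβi htp hn hj]
  exact intervalIntegral.integral_nonneg (htp n hn).le fun t _ =>
    sub_nonneg.2 (kernelPrimitive_mono hβ0 hβi (sub_le_sub_left (htp j (by omega)).le t))

theorem sum_qweight_row (hβ0 : ∀ s ∈ Set.Ioi (0:ℝ), 0 ≤ β s)
    (hβi : IntegrableOn β (Set.Ioi 0)) (h0 : tp 0 = 0)
    (htp : ∀ n < N, tp n < tp (n + 1)) {n : ℕ} (hn : n < N) :
    ∑ j ∈ range (n + 1), qweight β tp (n + 1) (j + 1) =
      ∫ t in (tp n)..(tp (n + 1)), kernelPrimitive β t := by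
  have hI := fun d => intervalIntegrable_kernelPrimitive hβ0 hβi d (tp n) (tp (n + 1))
  rw [sum_congr rfl fun j hj => qweight_eq hβi htp hn (Nat.lt_succ_iff.1 (mem_range.1 hj)),
    ← intervalIntegral.integral_finsetSum fun j _ => (hI _).sub (hI _)]
  refine intervalIntegral.integral_congr fun t ht => ?_
  rw [Set.uIcc_of_le (htp n hn).le] at ht
  rw [sum_range_sub' (fun j => kernelPrimitive β (t - tp j)), h0, sub_zero,
    kernelPrimitive_of_nonpos (sub_nonpos.2 ht.2), sub_zero]

theorem sum_qweight_row_le (hβ0 : ∀ s ∈ Set.Ioi (0:ℝ), 0 ≤ β s)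
    (hβi : IntegrableOn β (Set.Ioi 0)) (h0 : tp 0 = 0)
    (htp : ∀ n < N, tp n < tp (n + 1)) {n : ℕ} (hn : n < N) :
    ∑ j ∈ range (n + 1), qweight β tp (n + 1) (j + 1) ≤
      (∫ s in Set.Ioi (0:ℝ), β s) * kstep tp (n + 1) := by
  rw [sum_qweight_row hβ0 hβi h0 htp hn]
  have := intervalIntegral.integral_mono_on (μ := volume) (htp n hn).le
    (Monotone.intervalIntegrable (kernelPrimitive_mono hβ0 hβi)) intervalIntegrable_const
    fun t _ => kernelPrimitive_le hβ0 hβi t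
  simpa [kstep, mul_comm] using this

theorem sum_qweight_column_le (hβ0 : ∀ s ∈ Set.Ioi (0:ℝ), 0 ≤ β s)
    (hβi : IntegrableOn β (Set.Ioi 0)) (htp : ∀ n < N, tp n < tp (n + 1)) {j : ℕ} (hj : j < N) :
    ∑ n ∈ Ico j N, qweight β tp (n + 1) (j + 1) ≤
      (∫ s in Set.Ioi (0:ℝ), β s) * kstep tp (j + 1) := by
  have hI := fun d a b => intervalIntegrable_kernelPrimitive hβ0 hβi d a b
  have hM := fun a b => (kernelPrimitive_mono hβ0 hβi).intervalIntegrable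
    (μ := volume) (a := a) (b := b)
  rw [sum_congr rfl fun n hn => qweight_eq hβi htp (mem_Ico.1 hn).2 (mem_Ico.1 hn).1,
    intervalIntegral.sum_integral_adjacent_intervals_Ico (a := tp) hj.le
      fun n _ => (hI _ _ _).sub (hI _ _ _),
    intervalIntegral.integral_sub (hI _ _ _) (hI _ _ _),
    intervalIntegral.integral_comp_sub_right, intervalIntegral.integral_comp_sub_right, sub_self]
  have hzero : ∫ t in (tp j - tp (j + 1))..0, kernelPrimitive β t = 0 := by
    rw [intervalIntegral.integral_congr (g := fun _ => (0:ℝ)), intervalIntegral.integral_zero]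
    intro t ht
    rw [Set.uIcc_of_le (sub_nonpos.2 (htp j hj).le)] at ht
    exact kernelPrimitive_of_nonpos ht.2
  rw [← intervalIntegral.integral_add_adjacent_intervals (hM (tp j - tp (j + 1)) 0)
    (hM 0 (tp N - tp (j + 1))), hzero, zero_add,
    intervalIntegral.integral_interval_sub_left (hM _ _) (hM _ _)]
  have hle := (htp j hj).le
  have := intervalIntegral.integral_mono_on (μ := volume) (sub_le_sub_left hle (tp N))
    (hM _ _) intervalIntegrable_const fun t _ => kernelPrimitive_le hβ0 hβi t
  refine this.trans_eq ?_
  simp [kstep, mul_comm]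

/-- The normalized memory weights of step `n → n + 1`; the index `0` carries the remaining mass
of the kernel. -/
noncomputable def memoryWeight (β : ℝ → ℝ) (tp : ℕ → ℝ) (n : ℕ) : ℕ → ℝ
  | 0 => (∫ s in Set.Ioi (0:ℝ), β s) -
      (∑ j ∈ range (n + 1), qweight β tp (n + 1) (j + 1)) / kstep tp (n + 1)
  | j + 1 => qweight β tp (n + 1) (j + 1) / kstep tp (n + 1)

theorem kstep_pos (htp : ∀ n < N, tp n < tp (n + 1)) {n : ℕ} (hn : n < N) :
    0 < kstep tp (n + 1) := sub_pos.2 (htp n hn)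

theorem memoryWeight_nonneg (hβ0 : ∀ s ∈ Set.Ioi (0:ℝ), 0 ≤ β s)
    (hβi : IntegrableOn β (Set.Ioi 0)) (h0 : tp 0 = 0) (htp : ∀ n < N, tp n < tp (n + 1))
    {n j : ℕ} (hn : n < N) (hj : j ≤ n) : 0 ≤ memoryWeight β tp n j := by
  cases j with
  | zero =>
    exact sub_nonneg.2 ((div_le_iff₀ (kstep_pos htp hn)).2
      (sum_qweight_row_le hβ0 hβi h0 htp hn))
  | succ j =>
    exact div_nonneg (qweight_nonneg hβ0 hβi htp hn (by omega)) (kstep_pos htp hn).le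

theorem memoryWeight_succ_le (hβ0 : ∀ s ∈ Set.Ioi (0:ℝ), 0 ≤ β s)
    (hβa : AntitoneOn β (Set.Ioi 0)) (hβi : IntegrableOn β (Set.Ioi 0)) (h0 : tp 0 = 0)
    (htp : ∀ n < N, tp n < tp (n + 1)) {n j : ℕ} (hn : n + 1 < N) (hj : j ≤ n) :
    memoryWeight β tp (n + 1) j ≤ memoryWeight β tp n j := by
  have hn' : n < N := by omega
  cases j with
  | zero =>
    refine sub_le_sub_left ?_ _
    rw [sum_qweight_row hβ0 hβi h0 htp hn, sum_qweight_row hβ0 hβi h0 htp hn']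
    have := average_le_of_antitoneOn (htp n hn') (htp (n + 1) hn)
      ((kernelPrimitive_mono hβ0 hβi).neg.antitoneOn (Set.Icc (tp n) (tp (n + 1 + 1))))
    simp only [intervalIntegral.integral_neg, neg_div, neg_le_neg_iff] at this
    exact this
  | succ j =>
    simp only [memoryWeight]
    rw [qweight_eq hβi htp hn (by omega), qweight_eq hβi htp hn' (by omega)]
    refine average_le_of_antitoneOn (htp n hn') (htp (n + 1) hn) fun t ht t' _ htt => ?_
    exact kernelPrimitive_sub_antitone hβa hβi (htp j (by omega)).le
      ((partition_mono htp hj hn'.le).trans ht.1) htt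

theorem sum_memoryWeight (n : ℕ) :
    ∑ j ∈ range (n + 1), memoryWeight β tp n j =
      (∫ s in Set.Ioi (0:ℝ), β s) - qweight β tp (n + 1) (n + 1) / kstep tp (n + 1) := by
  rw [sum_range_succ']
  simp only [memoryWeight]
  rw [sum_range_succ, add_div, sum_div]
  ring

/-- The discrete convolution rewritten through differences with the current value. -/
theorem smul_sub_sum_qweight {H : Type*} [NormedAddCommGroup H] [NormedSpace ℝ H] (φ : ℕ → H)
    (hφ : φ 0 = 0) {n : ℕ} (hk : kstep tp (n + 1) ≠ 0) :
    kstep tp (n + 1) • ((1 - ∫ s in Set.Ioi (0:ℝ), β s) • φ (n + 1)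
        + ∑ j ∈ range (n + 1), memoryWeight β tp n j • (φ (n + 1) - φ j)) =
      kstep tp (n + 1) • φ (n + 1)
        - ∑ j ∈ range (n + 1), qweight β tp (n + 1) (j + 1) • φ (j + 1) := by
  simp only [smul_sub, sum_sub_distrib]
  rw [← sum_smul, sum_memoryWeight, sum_range_succ' (fun j => memoryWeight β tp n j • φ j), hφ,
    smul_zero, add_zero, sum_range_succ (fun j => qweight β tp (n + 1) (j + 1) • φ (j + 1))]
  simp only [memoryWeight, smul_add, smul_sub, smul_sum, smul_smul, mul_div_cancel₀ _ hk]
  rw [mul_sub, mul_sub, mul_div_cancel₀ _ hk, sub_smul, sub_smul, mul_one]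
  abel

end Weights

section Consistency

variable {H : Type*} [NormedAddCommGroup H] [NormedSpace ℝ H] {β : ℝ → ℝ} {tp : ℕ → ℝ} {N : ℕ}

theorem integral_deriv_eq_sub_of_Icc [CompleteSpace H] {T : ℝ} {u u' : ℝ → H}
    (hu : ∀ t ∈ Set.Icc (0:ℝ) T, HasDerivWithinAt u (u' t) (Set.Icc 0 T) t)
    (hu' : ContinuousOn u' (Set.Icc 0 T)) {a b : ℝ} (ha : 0 ≤ a) (hab : a ≤ b) (hb : b ≤ T) :
    ∫ t in a..b, u' t = u b - u a := by
  have hsub : Set.Icc a b ⊆ Set.Icc 0 T := Set.Icc_subset_Icc ha hb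
  refine intervalIntegral.integral_eq_sub_of_hasDerivAt_of_le hab
    (fun t ht => ((hu t (hsub ht)).continuousWithinAt).mono hsub) (fun t ht => ?_)
    ((hu'.mono hsub).intervalIntegrable_of_Icc hab)
  exact (hu t (hsub ⟨ht.1.le, ht.2.le⟩)).hasDerivAt
    (Icc_mem_nhds (ha.trans_lt ht.1) (ht.2.trans_le hb))

theorem norm_map_sub_le_integral [CompleteSpace H] (L : H →L[ℝ] H) {T : ℝ} {u u' : ℝ → H}
    (hu : ∀ t ∈ Set.Icc (0:ℝ) T, HasDerivWithinAt u (u' t) (Set.Icc 0 T) t)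
    (hu' : ContinuousOn u' (Set.Icc 0 T)) {a b s : ℝ} (ha : 0 ≤ a) (hs : s ∈ Set.Icc a b)
    (hb : b ≤ T) : ‖L (u s) - L (u b)‖ ≤ ∫ t in a..b, ‖L (u' t)‖ := by
  have hc : ContinuousOn u' (Set.Icc a b) := hu'.mono (Set.Icc_subset_Icc ha hb)
  have hab := hs.1.trans hs.2
  have hc' : ContinuousOn (fun t => ‖L (u' t)‖) (Set.Icc a b) :=
    (L.continuous.comp_continuousOn hc).norm
  rw [norm_sub_rev, ← map_sub, ← integral_deriv_eq_sub_of_Icc hu hu' (ha.trans hs.1) hs.2 hb,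
    ← L.intervalIntegral_comp_comm
      ((hc.mono (Set.Icc_subset_Icc_left hs.1)).intervalIntegrable_of_Icc hs.2)]
  refine (intervalIntegral.norm_integral_le_integral_norm hs.2).trans ?_
  exact intervalIntegral.integral_mono_interval hs.1 hs.2 le_rfl
    (Filter.Eventually.of_forall fun _ => norm_nonneg _) (hc'.intervalIntegrable_of_Icc hab)

/-- Pointwise error of the memory term when the argument is replaced by its right-endpoint
interpolant. -/
theorem norm_convolution_sub_le [CompleteSpace H] (hβ0 : ∀ s ∈ Set.Ioi (0:ℝ), 0 ≤ β s)
    (hβi : IntegrableOn β (Set.Ioi 0)) (h0 : tp 0 = 0) (htp : ∀ n < N, tp n < tp (n + 1))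
    {y : ℝ → H} (hy : ContinuousOn y (Set.Icc 0 (tp N))) {D : ℕ → ℝ}
    (hD : ∀ j < N, ∀ s ∈ Set.Icc (tp j) (tp (j + 1)), ‖y s - y (tp (j + 1))‖ ≤ D j)
    {n : ℕ} (hn : n < N) {t : ℝ} (ht : t ∈ Set.Ioc (tp n) (tp (n + 1))) :
    ‖(∫ s in (0:ℝ)..t, β (t - s) • y s) - ∑ j ∈ range (n + 1),
        (kernelPrimitive β (t - tp j) - kernelPrimitive β (t - tp (j + 1))) • y (tp (j + 1))‖ ≤
      ∑ j ∈ range (n + 1),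
        (kernelPrimitive β (t - tp j) - kernelPrimitive β (t - tp (j + 1))) * D j := by
  have hle : ∀ j ≤ n, tp j ≤ t := fun j hj => (partition_mono htp hj hn.le).trans ht.1.le
  have hpos : ∀ j ≤ N, 0 ≤ tp j := fun j hj => h0 ▸ partition_mono htp (Nat.zero_le j) hj
  have hmin : ∀ j ≤ n, tp j ≤ min (tp (j + 1)) t := fun j hj =>
    le_min (htp j (by omega)).le (hle j hj)
  have ht0 : 0 ≤ t := h0 ▸ hle 0 (Nat.zero_le n)
  have hk : ∀ a b : ℝ, a ≤ t → b ≤ t → IntervalIntegrable (fun s => β (t - s)) volume a b :=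
    fun a b ha hb => by
      simpa using (intervalIntegrable_of_nonneg hβi (sub_nonneg.2 ha)
        (sub_nonneg.2 hb)).comp_sub_left t
  have hky : ∀ j ≤ n, IntervalIntegrable (fun s => β (t - s) • y s) volume
      (tp j) (min (tp (j + 1)) t) := fun j hj => by
    refine (hk _ _ (hle j hj) (min_le_right _ _)).smul_continuousOn (hy.mono ?_)
    rw [Set.uIcc_of_le (hmin j hj)]
    exact Set.Icc_subset_Icc (hpos j (by omega))
      ((min_le_left _ _).trans (partition_mono htp (by omega) le_rfl))
  have hsplit : ∫ s in (0:ℝ)..t, β (t - s) • y s =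
      ∑ j ∈ range (n + 1), ∫ s in (tp j)..(min (tp (j + 1)) t), β (t - s) • y s := by
    have := intervalIntegral.sum_integral_adjacent_intervals (μ := volume)
      (f := fun s => β (t - s) • y s) (a := fun j => min (tp j) t) (n := n + 1) fun j hj => by
        simpa only [min_eq_left (hle j (by omega))] using hky j (by omega)
    rw [h0, min_eq_left ht0, min_eq_right ht.2] at this
    rw [← this]
    refine sum_congr rfl fun j hj => ?_
    rw [min_eq_left (hle j (Nat.lt_succ_iff.1 (mem_range.1 hj)))]
  rw [hsplit, ← sum_sub_distrib]
  refine norm_sum_le_of_le _ fun j hj => ?_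
  have hj : j ≤ n := Nat.lt_succ_iff.1 (mem_range.1 hj)
  have hkj := hk _ _ (hle j hj) (min_le_right (tp (j + 1)) t)
  rw [← integral_kernel_eq hβi _ (hle j hj), ← intervalIntegral.integral_smul_const,
    ← intervalIntegral.integral_mul_const, ← intervalIntegral.integral_sub (hky j hj)
      (hkj.smul_continuousOn continuousOn_const)]
  refine intervalIntegral.norm_integral_le_of_norm_le (hmin j hj) ?_ (hkj.mul_const _)
  filter_upwards [Measure.ae_ne volume t] with s hst hs
  have hst : 0 < t - s :=
    sub_pos.2 (lt_of_le_of_ne (hs.2.trans (min_le_right _ _)) hst)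
  rw [← smul_sub, norm_smul, Real.norm_of_nonneg (hβ0 _ hst)]
  exact mul_le_mul_of_nonneg_left
    (hD j (by omega) s ⟨hs.1.le, hs.2.trans (min_le_left _ _)⟩) (hβ0 _ hst)

/-- The consistency error of the scheme at one time step. -/
theorem norm_consistency_le [CompleteSpace H] (hβ0 : ∀ s ∈ Set.Ioi (0:ℝ), 0 ≤ β s)
    (hβi : IntegrableOn β (Set.Ioi 0)) (h0 : tp 0 = 0) (htp : ∀ n < N, tp n < tp (n + 1))
    {ρ : ℝ} {f y w w' : ℝ → H} (hf : IntegrableOn f (Set.Icc 0 (tp N)))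
    (hy : ContinuousOn y (Set.Icc 0 (tp N)))
    (hw : ∀ t ∈ Set.Icc (0:ℝ) (tp N), HasDerivWithinAt w (w' t) (Set.Icc 0 (tp N)) t)
    (hw' : ContinuousOn w' (Set.Icc 0 (tp N)))
    (heq : ∀ t ∈ Set.Icc (0:ℝ) (tp N),
      ρ • w' t + y t - ∫ s in (0:ℝ)..t, β (t - s) • y s = f t) {D : ℕ → ℝ}
    (hD : ∀ j < N, ∀ s ∈ Set.Icc (tp j) (tp (j + 1)), ‖y s - y (tp (j + 1))‖ ≤ D j)
    {n : ℕ} (hn : n < N) :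
    ‖(∫ t in (tp n)..(tp (n + 1)), f t) - (ρ • (w (tp (n + 1)) - w (tp n))
        + (kstep tp (n + 1) • y (tp (n + 1))
          - ∑ j ∈ range (n + 1), qweight β tp (n + 1) (j + 1) • y (tp (j + 1))))‖ ≤
      kstep tp (n + 1) * D n + ∑ j ∈ range (n + 1), qweight β tp (n + 1) (j + 1) * D j := by
  have hle := (htp n hn).le
  have hpos : 0 ≤ tp n := h0 ▸ partition_mono htp (Nat.zero_le n) hn.le
  have hT : tp (n + 1) ≤ tp N := partition_mono htp hn le_rfl
  have hsub : Set.Icc (tp n) (tp (n + 1)) ⊆ Set.Icc 0 (tp N) := Set.Icc_subset_Icc hpos hT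
  have hK : ∀ j, IntervalIntegrable
      (fun t => kernelPrimitive β (t - tp j) - kernelPrimitive β (t - tp (j + 1))) volume
      (tp n) (tp (n + 1)) := fun j =>
    (intervalIntegrable_kernelPrimitive hβ0 hβi _ _ _).sub
      (intervalIntegrable_kernelPrimitive hβ0 hβi _ _ _)
  have hKy : ∀ j, IntervalIntegrable (fun t => (kernelPrimitive β (t - tp j)
      - kernelPrimitive β (t - tp (j + 1))) • y (tp (j + 1))) volume
      (tp n) (tp (n + 1)) := fun j => (hK j).smul_continuousOn continuousOn_const
  have hf' : IntervalIntegrable f volume (tp n) (tp (n + 1)) :=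
    (intervalIntegrable_iff_integrableOn_Icc_of_le hle).2 (hf.mono_set hsub)
  have hw'i : IntervalIntegrable (fun t => ρ • w' t) volume (tp n) (tp (n + 1)) :=
    ((hw'.mono hsub).intervalIntegrable_of_Icc hle).smul ρ
  have hsumi : IntervalIntegrable (fun t => ∑ j ∈ range (n + 1), (kernelPrimitive β (t - tp j)
      - kernelPrimitive β (t - tp (j + 1))) • y (tp (j + 1))) volume
      (tp n) (tp (n + 1)) := by
    simpa only [Finset.sum_fn] using IntervalIntegrable.sum (range (n + 1)) fun j _ => hKy j
  have hci : IntervalIntegrable (fun _ : ℝ => y (tp (n + 1))) volume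
      (tp n) (tp (n + 1)) := intervalIntegrable_const
  have hrow : ∀ j ∈ range (n + 1), qweight β tp (n + 1) (j + 1) = _ := fun j hj =>
    qweight_eq hβi htp hn (Nat.lt_succ_iff.1 (mem_range.1 hj))
  have hleft : ∫ t in (tp n)..(tp (n + 1)), (f t - (ρ • w' t + (y (tp (n + 1))
      - ∑ j ∈ range (n + 1), (kernelPrimitive β (t - tp j)
        - kernelPrimitive β (t - tp (j + 1))) • y (tp (j + 1))))) =
      (∫ t in (tp n)..(tp (n + 1)), f t) - (ρ • (w (tp (n + 1)) - w (tp n))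
        + (kstep tp (n + 1) • y (tp (n + 1))
          - ∑ j ∈ range (n + 1), qweight β tp (n + 1) (j + 1) • y (tp (j + 1)))) := by
    rw [intervalIntegral.integral_sub hf' (hw'i.add (hci.sub hsumi)),
      intervalIntegral.integral_add hw'i (hci.sub hsumi),
      intervalIntegral.integral_sub hci hsumi, intervalIntegral.integral_const,
      intervalIntegral.integral_smul, integral_deriv_eq_sub_of_Icc hw hw' hpos hle hT,
      intervalIntegral.integral_finsetSum fun j _ => hKy j]
    simp only [intervalIntegral.integral_smul_const]
    rw [sum_congr rfl fun j hj => by rw [← hrow j hj]]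
    rfl
  have hKD : ∀ j, IntervalIntegrable (fun t => (kernelPrimitive β (t - tp j)
      - kernelPrimitive β (t - tp (j + 1))) * D j) volume
      (tp n) (tp (n + 1)) := fun j => (hK j).mul_const _
  have hDi : IntervalIntegrable (fun t => ∑ j ∈ range (n + 1), (kernelPrimitive β (t - tp j)
      - kernelPrimitive β (t - tp (j + 1))) * D j) volume
      (tp n) (tp (n + 1)) := by
    simpa only [Finset.sum_fn] using IntervalIntegrable.sum (range (n + 1)) fun j _ => hKD j
  have hright : ∫ t in (tp n)..(tp (n + 1)), (D n + ∑ j ∈ range (n + 1),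
      (kernelPrimitive β (t - tp j) - kernelPrimitive β (t - tp (j + 1))) * D j) =
      kstep tp (n + 1) * D n + ∑ j ∈ range (n + 1), qweight β tp (n + 1) (j + 1) * D j := by
    rw [intervalIntegral.integral_add intervalIntegrable_const hDi,
      intervalIntegral.integral_const, intervalIntegral.integral_finsetSum fun j _ => hKD j]
    simp only [intervalIntegral.integral_mul_const]
    rw [sum_congr rfl fun j hj => by rw [← hrow j hj]]
    rfl
  rw [← hleft, ← hright]
  refine intervalIntegral.norm_integral_le_of_norm_le hle
    (Filter.Eventually.of_forall fun t ht => ?_) (intervalIntegrable_const.add hDi)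
  rw [← heq t (hsub ⟨ht.1.le, ht.2⟩)]
  have e : ∀ a b c d z : H, a + b - c - (a + (d - z)) = (b - d) - (c - z) := fun a b c d z => by
    abel
  rw [e]
  exact (norm_sub_le _ _).trans (add_le_add (hD n hn t ⟨ht.1.le, ht.2⟩)
    (norm_convolution_sub_le hβ0 hβi h0 htp hy hD hn ht))

end Consistency

/-- First a priori error estimate (Theorem 5.1, estimate (5.1)): there is a
constant `C` depending only on `γ` and `ρ` such that
`‖A^{1/2}(U_{1,N} − u_1(T))‖ + ‖U_{2,N} − u_2(T)‖
  ≤ C Σ_{n=1}^N k_n ∫_{I_n} (‖A^{1/2} u_2'‖ + ‖A u_1'‖) dt`.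
Here `sqrtA` is the positive square root `A^{1/2}` of `A`, and `u1d`, `u2d`
denote the derivatives of the exact solution `u_1`, `u_2`. -/
theorem dG0_apriori_error_first.{u} (γ ρ : ℝ) (hγ0 : 0 < γ) (hγ1 : γ < 1) (hρ : 0 < ρ) :
    ∃ C : ℝ, 0 < C ∧
      ∀ (H : Type u) [NormedAddCommGroup H] [InnerProductSpace ℝ H] [CompleteSpace H],
      ∀ (N : ℕ), 1 ≤ N → ∀ (tp : ℕ → ℝ), tp 0 = 0 → (∀ n < N, tp n < tp (n + 1)) →
      ∀ (β : ℝ → ℝ), (∀ s ∈ Set.Ioi (0:ℝ), 0 ≤ β s) → AntitoneOn β (Set.Ioi 0) →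
        LocallyIntegrableOn β (Set.Ioi 0) → (∫ s in Set.Ioi (0:ℝ), β s) = γ →
      ∀ (A sqrtA : H →L[ℝ] H),
        (∀ x y : H, ⟪A x, y⟫ = ⟪x, A y⟫) →
        (∃ c > 0, ∀ x : H, c * ‖x‖ ^ 2 ≤ ⟪A x, x⟫) →
        (∀ x y : H, ⟪sqrtA x, y⟫ = ⟪x, sqrtA y⟫) →
        (∀ x : H, 0 ≤ ⟪sqrtA x, x⟫) →
        (∀ x : H, sqrtA (sqrtA x) = A x) →
      ∀ (f : ℝ → H), IntegrableOn f (Set.Icc 0 (tp N)) →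
      ∀ (u1 u2 u1d u2d : ℝ → H),
        (∀ t ∈ Set.Icc (0:ℝ) (tp N), HasDerivWithinAt u1 (u1d t) (Set.Icc 0 (tp N)) t) →
        (∀ t ∈ Set.Icc (0:ℝ) (tp N), HasDerivWithinAt u2 (u2d t) (Set.Icc 0 (tp N)) t) →
        ContinuousOn u1d (Set.Icc 0 (tp N)) →
        ContinuousOn u2d (Set.Icc 0 (tp N)) →
        (∀ t ∈ Set.Icc (0:ℝ) (tp N), u1d t = u2 t) →
        (∀ t ∈ Set.Icc (0:ℝ) (tp N),
          ρ • u2d t + A (u1 t) - ∫ s in (0:ℝ)..t, β (t - s) • A (u1 s) = f t) →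
      ∀ (U1 U2 : ℕ → H), U1 0 = u1 0 → U2 0 = u2 0 →
        (∀ n : ℕ, 1 ≤ n → n ≤ N → U1 n - U1 (n - 1) = kstep tp n • U2 n) →
        (∀ n : ℕ, 1 ≤ n → n ≤ N →
          ρ • (U2 n - U2 (n - 1)) + (kstep tp n - qweight β tp n n) • A (U1 n)
              - ∑ j ∈ Finset.Ico 1 n, qweight β tp n j • A (U1 j)
            = ∫ t in (tp (n - 1))..(tp n), f t) →
      ‖sqrtA (U1 N - u1 (tp N))‖ + ‖U2 N - u2 (tp N)‖
        ≤ C * ∑ n ∈ Finset.Icc 1 N, kstep tp n *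
            ∫ t in (tp (n - 1))..(tp n), (‖sqrtA (u2d t)‖ + ‖A (u1d t)‖) := by
  have hκ : 0 < min ρ (1 - γ) := lt_min hρ (sub_pos.2 hγ1)
  refine ⟨16 / min ρ (1 - γ), by positivity, ?_⟩
  intro H _ _ _ N _ tp h0 htp β hβ0 hβa _ hβγ A sqrtA _ _ hS _ hSS f hf u1 u2 u1d u2d hu1 hu2
    hu1d hu2d h12 heq U1 U2 hU1 hU2 hs1 hs2
  have hβi : IntegrableOn β (Set.Ioi 0) := by
    by_contra h
    rw [integral_undef h] at hβγ
    exact hγ0.ne hβγ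
  have hpos : ∀ n ≤ N, 0 ≤ tp n := fun n hn => h0 ▸ partition_mono htp (Nat.zero_le n) hn
  have hmem : ∀ n ≤ N, tp n ∈ Set.Icc 0 (tp N) := fun n hn =>
    ⟨hpos n hn, partition_mono htp hn le_rfl⟩
  have hAc : ContinuousOn (fun t => A (u1 t)) (Set.Icc 0 (tp N)) :=
    A.continuous.comp_continuousOn fun t ht => (hu1 t ht).continuousWithinAt
  set D : ℕ → ℝ := fun j => ∫ t in (tp j)..(tp (j + 1)), ‖A (u1d t)‖
  set E : ℕ → ℝ := fun j => ∫ t in (tp j)..(tp (j + 1)), ‖sqrtA (u2d t)‖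
  have hD : ∀ j < N, ∀ s ∈ Set.Icc (tp j) (tp (j + 1)),
      ‖A (u1 s) - A (u1 (tp (j + 1)))‖ ≤ D j := fun j hj s hs =>
    norm_map_sub_le_integral A hu1 hu1d (hpos j hj.le) hs (hmem (j + 1) hj).2
  have hE : ∀ j < N, ∀ s ∈ Set.Icc (tp j) (tp (j + 1)),
      ‖sqrtA (u2 s) - sqrtA (u2 (tp (j + 1)))‖ ≤ E j := fun j hj s hs =>
    norm_map_sub_le_integral sqrtA hu2 hu2d (hpos j hj.le) hs (hmem (j + 1) hj).2
  have hD0 : ∀ j < N, 0 ≤ D j := fun j hj =>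
    intervalIntegral.integral_nonneg (htp j hj).le fun t _ => norm_nonneg _
  have hE0 : ∀ j < N, 0 ≤ E j := fun j hj =>
    intervalIntegral.integral_nonneg (htp j hj).le fun t _ => norm_nonneg _
  set φ : ℕ → H := fun n => sqrtA (U1 n - u1 (tp n)) with hφdef
  set v : ℕ → H := fun n => U2 n - u2 (tp n) with hvdef
  have hφ0 : φ 0 = 0 := by simp [hφdef, hU1, h0]
  have hv0 : v 0 = 0 := by simp [hvdef, hU2, h0]
  set ε : ℕ → H := fun n => φ (n + 1) - φ n - kstep tp (n + 1) • sqrtA (v (n + 1)) with hεdef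
  set g : ℕ → H := fun n => ρ • (v (n + 1) - v n) + kstep tp (n + 1) • sqrtA ((1 - γ) • φ (n + 1)
    + ∑ j ∈ range (n + 1), memoryWeight β tp n j • (φ (n + 1) - φ j)) with hgdef
  have hε : ∀ n < N, ‖ε n‖ ≤ kstep tp (n + 1) * E n := by
    intro n hn
    have hu := integral_deriv_eq_sub_of_Icc hu1 hu1d (hpos n hn.le) (htp n hn).le
      (hmem (n + 1) hn).2
    have hsub : Set.Icc (tp n) (tp (n + 1)) ⊆ Set.Icc 0 (tp N) :=
      Set.Icc_subset_Icc (hpos n hn.le) (hmem (n + 1) hn).2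
    have hi : IntervalIntegrable u1d volume (tp n) (tp (n + 1)) :=
      (hu1d.mono hsub).intervalIntegrable_of_Icc (htp n hn).le
    have hs := hs1 (n + 1) (by omega) hn
    rw [Nat.add_sub_cancel] at hs
    have hε' : ε n = -∫ t in (tp n)..(tp (n + 1)), sqrtA (u1d t - u2 (tp (n + 1))) := by
      rw [sqrtA.intervalIntegral_comp_comm (hi.sub intervalIntegrable_const),
        intervalIntegral.integral_sub hi intervalIntegrable_const, hu,
        intervalIntegral.integral_const, ← map_neg]
      simp only [hεdef, hφdef, hvdef]
      rw [← map_sub, ← map_smul, ← map_sub]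
      congr 1
      rw [smul_sub, ← hs]
      simp only [kstep, Nat.add_sub_cancel]
      abel
    rw [hε', norm_neg]
    have := intervalIntegral.norm_integral_le_of_norm_le_const (a := tp n) (b := tp (n + 1))
      (f := fun t => sqrtA (u1d t - u2 (tp (n + 1)))) (C := E n) fun t ht => by
        rw [Set.uIoc_of_le (htp n hn).le] at ht
        rw [h12 t (hsub ⟨ht.1.le, ht.2⟩), map_sub]
        exact hE n hn t ⟨ht.1.le, ht.2⟩
    rw [abs_of_pos (sub_pos.2 (htp n hn))] at this
    exact this.trans_eq (mul_comm _ _)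
  have hg : ∀ n < N, ‖g n‖ ≤ kstep tp (n + 1) * D n
      + ∑ j ∈ range (n + 1), qweight β tp (n + 1) (j + 1) * D j := by
    intro n hn
    refine le_of_eq_of_le (congrArg norm ?_)
      (norm_consistency_le (w := u2) hβ0 hβi h0 htp hf hAc hu2 hu2d (fun t ht => heq t ht) hD hn)
    have hs := hs2 (n + 1) (by omega) hn
    simp only [Nat.add_sub_cancel, sum_Ico_eq_sum_range] at hs
    rw [← hs, hgdef, ← hβγ]
    simp only
    rw [← map_smul, smul_sub_sum_qweight φ hφ0 (kstep_pos htp hn).ne']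
    simp only [hφdef, hvdef, map_sub, map_smul, map_sum, hSS, smul_sub, sub_smul,
      sum_sub_distrib]
    simp only [sum_range_succ, add_comm 1]
    abel
  obtain ⟨p, hp, hpmax⟩ := exists_max_image (range (N + 1)) (fun n => ‖v n‖) ⟨0, by simp⟩
  obtain ⟨q, hq, hqmax⟩ := exists_max_image (range (N + 1)) (fun n => ‖φ n‖) ⟨0, by simp⟩
  have hpN : p ≤ N := Nat.lt_succ_iff.1 (mem_range.1 hp)
  have hqN : q ≤ N := Nat.lt_succ_iff.1 (mem_range.1 hq)
  have hV : ∀ n ≤ N, ‖v n‖ ≤ ‖v p‖ := fun n hn => hpmax n (by simpa [Nat.lt_succ_iff] using hn)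
  have hΦ : ∀ n ≤ N, ‖φ n‖ ≤ ‖φ q‖ := fun n hn => hqmax n (by simpa [Nat.lt_succ_iff] using hn)
  have hstab := discrete_energy_stability sqrtA hS hρ hγ1 N (fun n => kstep tp (n + 1))
    (memoryWeight β tp) φ v g ε hV hΦ hφ0 hv0
    (fun n hn j hj => memoryWeight_nonneg hβ0 hβi h0 htp hn hj)
    (fun n hn j hj => memoryWeight_succ_le hβ0 hβa hβi h0 htp hn hj)
    (fun n hn => by
      rw [sum_memoryWeight, hβγ]
      exact sub_le_self _ (div_nonneg (qweight_nonneg hβ0 hβi htp hn le_rfl)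
        (kstep_pos htp hn).le))
    (fun n _ => by simp [hεdef]) (fun n _ => rfl)
  set S := ∑ n ∈ range N, kstep tp (n + 1) * (E n + D n) with hSdef
  have hS' : ∑ n ∈ Icc 1 N, kstep tp n *
      ∫ t in (tp (n - 1))..(tp n), (‖sqrtA (u2d t)‖ + ‖A (u1d t)‖) = S := by
    have hIcc : Icc 1 N = Ico 1 (N + 1) := by
      ext
      simp
    rw [hIcc, sum_Ico_eq_sum_range]
    simp only [Nat.add_sub_cancel, add_comm 1]
    refine sum_congr rfl fun n hn => ?_
    have hn := mem_range.1 hn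
    have hsub : Set.Icc (tp n) (tp (n + 1)) ⊆ Set.Icc 0 (tp N) :=
      Set.Icc_subset_Icc (hpos n hn.le) (hmem (n + 1) hn).2
    rw [intervalIntegral.integral_add]
    · exact ((sqrtA.continuous.comp_continuousOn
        (hu2d.mono hsub)).norm).intervalIntegrable_of_Icc (htp n hn).le
    · exact ((A.continuous.comp_continuousOn
        (hu1d.mono hsub)).norm).intervalIntegrable_of_Icc (htp n hn).le
  have hcol : ∑ n ∈ range N, ∑ j ∈ range (n + 1), qweight β tp (n + 1) (j + 1) * D j ≤
      ∑ j ∈ range N, kstep tp (j + 1) * D j := by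
    rw [range_eq_Ico]
    simp only [range_eq_Ico]
    rw [sum_sigma', sum_bij' (t := (Ico 0 N).sigma fun j => Ico j N)
      (g := fun x => qweight β tp (x.2 + 1) (x.1 + 1) * D x.1)
      (fun x _ => ⟨x.2, x.1⟩) (fun x _ => ⟨x.2, x.1⟩)
      (fun x hx => by simp only [mem_sigma, mem_Ico] at hx ⊢; omega)
      (fun x hx => by simp only [mem_sigma, mem_Ico] at hx ⊢; omega)
      (fun _ _ => rfl) (fun _ _ => rfl) (fun _ _ => rfl), sum_sigma]
    refine sum_le_sum fun j hj => ?_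
    have hj := (mem_Ico.1 hj).2
    simp only
    rw [← sum_mul]
    refine mul_le_mul_of_nonneg_right ((sum_qweight_column_le hβ0 hβi htp hj).trans ?_) (hD0 j hj)
    rw [hβγ]
    exact mul_le_of_le_one_left (kstep_pos htp hj).le hγ1.le
  have hsum : ∑ n ∈ range N, (‖g n‖ + 2 * ‖ε n‖) ≤ 2 * S := by
    have h₁ : ∑ n ∈ range N, (‖g n‖ + 2 * ‖ε n‖) ≤ ∑ n ∈ range N, ((kstep tp (n + 1) * D n
        + ∑ j ∈ range (n + 1), qweight β tp (n + 1) (j + 1) * D j)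
        + 2 * (kstep tp (n + 1) * E n)) :=
      sum_le_sum fun n hn => add_le_add (hg n (mem_range.1 hn))
        (mul_le_mul_of_nonneg_left (hε n (mem_range.1 hn)) zero_le_two)
    simp only [sum_add_distrib, ← mul_sum] at h₁ ⊢
    have h₂ : S = ∑ n ∈ range N, kstep tp (n + 1) * E n
        + ∑ n ∈ range N, kstep tp (n + 1) * D n := by
      rw [hSdef, ← sum_add_distrib]
      exact sum_congr rfl fun n _ => mul_add _ _ _
    linarith
  have hR : ∑ n ∈ range N, (‖g n‖ * ‖v p‖ + 2 * ‖ε n‖ * ‖φ q‖) ≤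
      2 * S * (‖v p‖ + ‖φ q‖) := by
    refine le_trans ?_ (mul_le_mul_of_nonneg_right hsum (by positivity))
    rw [sum_mul]
    refine sum_le_sum fun n _ => ?_
    have := norm_nonneg (g n)
    have := norm_nonneg (ε n)
    have := norm_nonneg (v p)
    have := norm_nonneg (φ q)
    have : 0 ≤ ‖g n‖ * ‖φ q‖ := by positivity
    have : 0 ≤ ‖ε n‖ * ‖v p‖ := by positivity
    nlinarith
  have hmono : ∀ m ≤ N, ρ * ‖v m‖ ^ 2 + (1 - γ) * ‖φ m‖ ^ 2 ≤
      4 * S * (‖v p‖ + ‖φ q‖) := fun m hm => by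
    refine (hstab m hm).trans ?_
    have : ∑ n ∈ range m, (‖g n‖ * ‖v p‖ + 2 * ‖ε n‖ * ‖φ q‖) ≤
        ∑ n ∈ range N, (‖g n‖ * ‖v p‖ + 2 * ‖ε n‖ * ‖φ q‖) :=
      sum_le_sum_of_subset_of_nonneg (range_mono hm) fun _ _ _ => by positivity
    linarith
  have hκV : min ρ (1 - γ) * ‖v p‖ ^ 2 ≤ 4 * S * (‖v p‖ + ‖φ q‖) := by
    have := mul_le_mul_of_nonneg_right (min_le_left ρ (1 - γ)) (sq_nonneg ‖v p‖)
    have := mul_nonneg (sub_nonneg.2 hγ1.le) (sq_nonneg ‖φ p‖)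
    linarith [hmono p hpN]
  have hκΦ : min ρ (1 - γ) * ‖φ q‖ ^ 2 ≤ 4 * S * (‖v p‖ + ‖φ q‖) := by
    have := mul_le_mul_of_nonneg_right (min_le_right ρ (1 - γ)) (sq_nonneg ‖φ q‖)
    have := mul_nonneg hρ.le (sq_nonneg ‖v q‖)
    linarith [hmono q hqN]
  have hS0 : 0 ≤ S := sum_nonneg fun n hn => by
    have hn := mem_range.1 hn
    exact mul_nonneg (kstep_pos htp hn).le (add_nonneg (hE0 n hn) (hD0 n hn))
  rw [hS', add_comm]
  refine (add_le_add (hV N le_rfl) (hΦ N le_rfl)).trans ?_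
  rw [div_mul_eq_mul_div, le_div_iff₀ hκ]
  rcases (add_nonneg (norm_nonneg (v p)) (norm_nonneg (φ q))).eq_or_lt with hz | hz
  · rw [← hz, zero_mul]
    positivity
  · refine le_of_mul_le_mul_right ?_ hz
    nlinarith [mul_nonneg hκ.le (sq_nonneg (‖v p‖ - ‖φ q‖))]
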